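/- Let n be a positive integer and f(q) ∈ ℤ[q] be such that f(ω_n^j) ∈ ℤ for all j = 1, …, n, where ω_n is a fixed primitive n-th root of unity. Then for every m, e ≥ 1 and every prime p, one has f(ω_n^{m p^e}) ≡ f(ω_n^{m p^{e−1}}) (mod p^e). Moreover, if p does not divide n, then f(ω_n^{m p^{e−1}}) = f(ω_n^{m p^e}). -/

import Mathlib

open Polynomial in
lemma aux_conj (N : ℕ) (hN : 0 < N) (x y : ℂ) (hx : IsPrimitiveRoot x N)
    (hy : IsPrimitiveRoot y N) (H : Polynomial ℤ) (z : ℤ) (h : aeval x H = (z : ℂ)) :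
    aeval y H = (z : ℂ) := by
  have h1 : minpoly ℤ x ∣ H - C z := by
    apply minpoly.isIntegrallyClosed_dvd (hx.isIntegral hN)
    simp [h]
  rw [← cyclotomic_eq_minpoly hx hN, cyclotomic_eq_minpoly hy hN] at h1
  obtain ⟨q, hq⟩ := h1
  have h2 : aeval y (H - C z) = 0 := by rw [hq]; simp
  have h3 : aeval y H - (z : ℂ) = 0 := by simpa using h2
  exact sub_eq_zero.mp h3

lemma aux_geom (n : ℕ) (x : ℂ) (hx : x ^ n = 1) :
    ∑ j ∈ Finset.range n, x ^ j = if x = 1 then (n : ℂ) else 0 := by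
  split_ifs with h
  · simp [h]
  · have := mul_geom_sum x n
    rw [hx, sub_self] at this
    exact (mul_eq_zero.mp this).resolve_left (sub_ne_zero.mpr h)

lemma aux_mod (n k l : ℕ) (hk : k < n) : n ∣ k + (n - 1) * l ↔ k = l % n := by
  have h1 : k + (n - 1) * l + l = k + n * l := by
    obtain ⟨t, rfl⟩ : ∃ t, n = t + 1 := ⟨n - 1, by omega⟩
    simp; ring
  have h2 : (n ∣ k + (n - 1) * l) ↔ k ≡ l [MOD n] := by
    constructor
    · intro h
      have : k + n * l ≡ 0 + l [MOD n] := by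
        rw [← h1]; exact Nat.ModEq.add_right l ((Nat.modEq_zero_iff_dvd).2 h)
      simpa [Nat.ModEq] using this
    · intro h
      apply (Nat.modEq_zero_iff_dvd).1
      apply Nat.ModEq.add_right_cancel' l
      rw [h1]; simpa [Nat.ModEq] using h
  rw [h2, Nat.ModEq, Nat.mod_eq_of_lt hk]

open Polynomial in
lemma aux_formula (n : ℕ) (hn : 0 < n) (ω : ℂ) (hω : IsPrimitiveRoot ω n)
    (f : Polynomial ℤ)
    (hf : ∀ j ∈ Finset.Icc 1 n, ∃ z : ℤ, Polynomial.aeval (ω ^ j) f = (z : ℂ)) :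
    ∃ B : ℕ → ℤ, ∀ j : ℕ, aeval (ω ^ j) f =
      ((∑ d ∈ n.divisors, B d * (if n ∣ j * d then ((n / d : ℕ) : ℤ) else 0) : ℤ) : ℂ) := by
  have hmon : (X ^ n - 1 : ℤ[X]).Monic := by
    simpa using monic_X_pow_sub_C (1 : ℤ) hn.ne'
  obtain ⟨r, hr⟩ : ∃ r, r = f %ₘ (X ^ n - 1 : ℤ[X]) := ⟨_, rfl⟩
  have hdeg : r.natDegree < n := by
    have h1 := natDegree_modByMonic_lt f hmon (by
      intro h
      have := congrArg natDegree h
      have h2 : (X ^ n - 1 : ℤ[X]).natDegree = n := by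
        simpa using natDegree_X_pow_sub_C (n := n) (r := (1 : ℤ))
      rw [h2] at this; simp at this; omega)
    have h2 : (X ^ n - 1 : ℤ[X]).natDegree = n := by
      simpa using natDegree_X_pow_sub_C (n := n) (r := (1 : ℤ))
    rw [h2] at h1; rw [hr]; exact h1
  have hωj : ∀ j : ℕ, (ω ^ j) ^ n = 1 := by
    intro j; rw [← pow_mul, mul_comm, pow_mul, hω.pow_eq_one, one_pow]
  have hG : ∀ j : ℕ, aeval (ω ^ j) f = ∑ k ∈ Finset.range n, (r.coeff k : ℂ) * ω ^ (j * k) := by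
    intro j
    have h1 : aeval (ω ^ j) f = aeval (ω ^ j) r := by
      conv_lhs => rw [← modByMonic_add_div f (X ^ n - 1 : ℤ[X])]
      simp [hωj, hr]
    rw [h1, aeval_eq_sum_range' hdeg]
    simp [pow_mul]
  have hGz : ∀ j, ∃ z : ℤ, j < n → aeval (ω ^ j) f = (z : ℂ) := by
    intro j
    by_cases hj : j < n
    · rcases Nat.eq_zero_or_pos j with rfl | h0
      · obtain ⟨z, hz⟩ := hf n (by simp; omega)
        exact ⟨z, fun _ => by rw [← hz, hω.pow_eq_one, pow_zero]⟩
      · obtain ⟨z, hz⟩ := hf j (by simp; omega)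
        exact ⟨z, fun _ => hz⟩
    · exact ⟨0, fun h => absurd h hj⟩
  choose G hGG using hGz
  have hH : ∀ l : ℕ, aeval (ω ^ l) (∑ j ∈ Finset.range n, C (G j) * X ^ ((n - 1) * j)) =
      (((n : ℤ) * r.coeff (l % n) : ℤ) : ℂ) := by
    intro l
    have h1 : aeval (ω ^ l) (∑ j ∈ Finset.range n, C (G j) * X ^ ((n - 1) * j)) =
        ∑ j ∈ Finset.range n, ∑ k ∈ Finset.range n,
          (r.coeff k : ℂ) * (ω ^ (k + (n - 1) * l)) ^ j := by
      rw [map_sum]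
      apply Finset.sum_congr rfl
      intro j hj
      have := hGG j (Finset.mem_range.1 hj)
      rw [map_mul, map_pow, aeval_X, aeval_C, algebraMap_int_eq, eq_intCast]
      rw [← this, hG, Finset.sum_mul]
      apply Finset.sum_congr rfl
      intro k _
      rw [mul_assoc, ← pow_mul, ← pow_mul, ← pow_add]
      congr 2; ring
    rw [h1, Finset.sum_comm]
    have h2 : ∀ k ∈ Finset.range n, ∑ j ∈ Finset.range n,
        (r.coeff k : ℂ) * (ω ^ (k + (n - 1) * l)) ^ j =
        if k = l % n then (r.coeff k : ℂ) * n else 0 := by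
      intro k hk
      rw [← Finset.mul_sum, aux_geom n _ (hωj _)]
      simp only [hω.pow_eq_one_iff_dvd, aux_mod n k l (Finset.mem_range.1 hk)]
      simp
    rw [Finset.sum_congr rfl h2, Finset.sum_ite_eq', if_pos (by simp [Nat.mod_lt _ hn])]
    push_cast; ring
  have hA : ∀ k : ℕ, r.coeff (k % n) = r.coeff (Nat.gcd k n % n) := by
    intro k
    have hd : 0 < Nat.gcd k n := Nat.gcd_pos_of_pos_right _ hn
    have hN : 0 < n / Nat.gcd k n := Nat.div_pos (Nat.gcd_le_right _ hn) hd
    have o : orderOf ω = n := hω.eq_orderOf.symm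
    have p1 : IsPrimitiveRoot (ω ^ k) (n / Nat.gcd k n) := by
      rw [IsPrimitiveRoot.iff_orderOf, IsOfFinOrder.orderOf_pow _ _ (orderOf_pos_iff.1 (o ▸ hn)),
        o, Nat.gcd_comm]
    have p2 : IsPrimitiveRoot (ω ^ (Nat.gcd k n)) (n / Nat.gcd k n) :=
      hω.pow hn (Nat.mul_div_cancel' (Nat.gcd_dvd_right k n)).symm
    have h1 := aux_conj _ hN _ _ p1 p2 _ _ (hH k)
    rw [hH] at h1
    have h2 := Int.cast_injective h1
    exact (mul_left_cancel₀ (by exact_mod_cast hn.ne') h2).symm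
  obtain ⟨B, hB⟩ : ∃ B : ℕ → ℤ, ∀ N : ℕ, 0 < N → ∑ d ∈ N.divisors, B d = r.coeff (N % n) := by
    refine ⟨_, (ArithmeticFunction.sum_eq_iff_sum_mul_moebius_eq
      (g := fun N => r.coeff (N % n))).2 fun N _ => rfl⟩
  refine ⟨B, fun j => ?_⟩
  have hc : ∀ k ∈ Finset.range n, r.coeff k = ∑ d ∈ n.divisors, if d ∣ k then B d else 0 := by
    intro k hk
    have := hA k
    rw [Nat.mod_eq_of_lt (Finset.mem_range.1 hk)] at this
    rw [this, ← hB _ (Nat.gcd_pos_of_pos_right _ hn), ← Finset.sum_filter]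
    apply Finset.sum_congr _ fun _ _ => rfl
    ext d
    simp [Nat.dvd_gcd_iff, hn.ne']
    tauto
  rw [hG]
  have h1 : ∑ k ∈ Finset.range n, (r.coeff k : ℂ) * ω ^ (j * k) =
      ∑ k ∈ Finset.range n, ∑ d ∈ n.divisors, (B d : ℂ) * if d ∣ k then ω ^ (j * k) else 0 := by
    apply Finset.sum_congr rfl
    intro k hk
    rw [hc k hk, Int.cast_sum, Finset.sum_mul]
    apply Finset.sum_congr rfl
    intro d _
    split_ifs <;> simp
  rw [h1, Finset.sum_comm, Int.cast_sum]
  apply Finset.sum_congr rfl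
  intro d hd
  obtain ⟨c, hc'⟩ := (Nat.mem_divisors.1 hd).1
  have hd0 : 0 < d := Nat.pos_of_mem_divisors hd
  have hcn : n / d = c := by rw [hc']; exact Nat.mul_div_cancel_left _ hd0
  rw [← Finset.mul_sum, Int.cast_mul]
  congr 1
  have h2 : ∑ k ∈ Finset.range n, (if d ∣ k then ω ^ (j * k) else 0) =
      ∑ i ∈ Finset.range c, (ω ^ (j * d)) ^ i := by
    rw [← Finset.sum_filter]
    symm
    apply Finset.sum_bij (fun i _ => d * i)
    · intro i hi
      simp only [Finset.mem_filter, Finset.mem_range] at hi ⊢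
      exact ⟨by rw [hc']; exact Nat.mul_lt_mul_of_pos_left hi hd0, Dvd.intro _ rfl⟩
    · intro a _ b _ h
      exact Nat.eq_of_mul_eq_mul_left hd0 h
    · intro b hb
      simp only [Finset.mem_filter, Finset.mem_range] at hb
      obtain ⟨hb, i, rfl⟩ := hb
      refine ⟨i, ?_, rfl⟩
      rw [hc'] at hb
      exact Finset.mem_range.2 (Nat.lt_of_mul_lt_mul_left hb)
    · intro i _
      rw [← pow_mul]; congr 1; ring
  rw [h2, aux_geom c _ (by
    rw [← pow_mul, mul_assoc, ← hc', mul_comm, pow_mul, hω.pow_eq_one, one_pow]), hcn]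
  simp only [hω.pow_eq_one_iff_dvd]
  split_ifs <;> simp

/-- If f ∈ ℤ[q] takes integer values at all n-th roots of unity, then for all
m, e ≥ 1 and primes p, f(ω^{mpᵉ}) ≡ f(ω^{mpᵉ⁻¹}) (mod pᵉ); moreover, if p ∤ n then the two
values are equal. -/
theorem stmt_2 (n : ℕ) (hn : 0 < n) (ω : ℂ) (hω : IsPrimitiveRoot ω n)
    (f : Polynomial ℤ)
    (hf : ∀ j ∈ Finset.Icc 1 n, ∃ z : ℤ, Polynomial.aeval (ω ^ j) f = (z : ℂ))
    (m e p : ℕ) (hm : 1 ≤ m) (he : 1 ≤ e) (hp : p.Prime) :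
    ∃ z w : ℤ, Polynomial.aeval (ω ^ (m * p ^ e)) f = (z : ℂ) ∧
      Polynomial.aeval (ω ^ (m * p ^ (e - 1))) f = (w : ℂ) ∧
      (p : ℤ) ^ e ∣ z - w ∧ (¬ (p ∣ n) → z = w) := by
  obtain ⟨B, hB⟩ := aux_formula n hn ω hω f hf
  refine ⟨_, _, hB _, hB _, ?_, ?_⟩
  · rw [← Finset.sum_sub_distrib]
    apply Finset.dvd_sum
    intro d hd
    obtain ⟨c, hc⟩ := (Nat.mem_divisors.1 hd).1
    have hd0 : 0 < d := Nat.pos_of_mem_divisors hd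
    have hcn : n / d = c := by rw [hc]; exact Nat.mul_div_cancel_left _ hd0
    have key : ∀ j, n ∣ j * d ↔ c ∣ j := by
      intro j; rw [hc, mul_comm d c]; exact Nat.mul_dvd_mul_iff_right hd0
    simp only [← mul_sub, key, hcn]
    apply Dvd.dvd.mul_left
    obtain ⟨e, rfl⟩ : ∃ t, e = t + 1 := ⟨e - 1, by omega⟩
    simp only [Nat.add_sub_cancel]
    by_cases h2 : c ∣ m * p ^ e
    · have h1 : c ∣ m * p ^ (e + 1) := h2.trans (Dvd.intro p (by ring))
      simp [h1, h2]
    · by_cases h1 : c ∣ m * p ^ (e + 1)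
      · simp only [h1, h2, if_true, if_false, sub_zero]
        obtain ⟨a, ha⟩ := h1
        have hpa : ¬ p ∣ a := by
          rintro ⟨b, rfl⟩
          apply h2
          refine ⟨b, Nat.eq_of_mul_eq_mul_right hp.pos ?_⟩
          calc _ = m * p ^ (e + 1) := by ring
            _ = _ := by rw [ha]; ring
        have : p ^ (e + 1) ∣ c * a := ha ▸ Dvd.intro_left m rfl
        have := (((Nat.Prime.coprime_iff_not_dvd hp).2 hpa).pow_left (e + 1)).dvd_of_dvd_mul_right this
        exact_mod_cast this
      · simp [h1, h2]
  · intro hpn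
    apply Finset.sum_congr rfl
    intro d hd
    have : n ∣ m * p ^ e * d ↔ n ∣ m * p ^ (e - 1) * d := by
      have hco : ∀ t, Nat.Coprime n (p ^ t) := fun t =>
        (((Nat.Prime.coprime_iff_not_dvd hp).2 hpn).pow_left t).symm
      have : ∀ t, n ∣ m * p ^ t * d ↔ n ∣ m * d := by
        intro t
        rw [mul_right_comm]
        exact (hco t).dvd_mul_right
      rw [this, this]
    simp only [this]
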